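/- Consider, for R > 0, the complex integral I(R) = ∫_0^π e^{i R e^{iθ}} / (1 + e^{2 i R e^{iθ}}) dθ. Then Re I(R) = π/2 for every R ∈ (0, π/2), and Re I(R) = π/2 − 2 for every R ∈ (π/2, 3π/2). -/

import Mathlib

noncomputable section

/-- I(R) = ∫_0^π e^{i R e^{iθ}} / (1 + e^{2 i R e^{iθ}}) dθ. -/
def Ifun (R : ℝ) : ℂ :=
  ∫ θ in (0 : ℝ)..Real.pi,
    Complex.exp (Complex.I * R * Complex.exp (Complex.I * θ)) /
      (1 + Complex.exp (2 * Complex.I * R * Complex.exp (Complex.I * θ)))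

lemma aux_integrand (w : ℂ) : Complex.exp (Complex.I * w) / (1 + Complex.exp (2 * Complex.I * w))
    = 1 / (2 * Complex.cos w) := by
  rw [Complex.cos]
  have h1 : Complex.exp (2 * Complex.I * w) = Complex.exp (Complex.I * w) * Complex.exp (Complex.I * w) := by
    rw [← Complex.exp_add]; congr 1; ring
  have h2 : Complex.exp (-w * Complex.I) = (Complex.exp (Complex.I * w))⁻¹ := by
    rw [← Complex.exp_neg]; congr 1; ring
  have h3 := Complex.exp_ne_zero (Complex.I * w)
  rw [h1, h2, mul_comm w]
  generalize Complex.exp (Complex.I * w) = e at *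
  have : 2 * ((e + e⁻¹) / 2) = (1 + e * e) / e := by field_simp; ring
  rw [this, one_div_div]

lemma aux_key (R : ℝ) (hR : 0 < R) (hc : ∀ z : ℂ, ‖z‖ = R → Complex.cos z ≠ 0) :
    2 * Complex.I * Ifun R = ∮ z in C(0, R), (z - 0)⁻¹ * (1 / (2 * Complex.cos z)) := by
  set F : ℝ → ℂ := fun θ => 1 / (2 * Complex.cos (circleMap 0 R θ)) with hF
  have hFc : Continuous F := by
    refine Continuous.div continuous_const ?_ ?_
    · exact continuous_const.mul (Complex.continuous_cos.comp (continuous_circleMap 0 R))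
    · intro θ
      refine mul_ne_zero two_ne_zero (hc _ ?_)
      rw [norm_circleMap_zero, abs_of_pos hR]
  have hI : Ifun R = ∫ θ in (0:ℝ)..Real.pi, F θ := by
    unfold Ifun
    congr 1
    funext θ
    rw [hF]
    simp only
    rw [← aux_integrand, circleMap_zero]
    have e1 : Complex.I * R * Complex.exp (Complex.I * θ) =
        Complex.I * (R * Complex.exp (θ * Complex.I)) := by
      rw [mul_comm (θ : ℂ)]; ring
    have e2 : 2 * Complex.I * R * Complex.exp (Complex.I * θ) =
        2 * Complex.I * (R * Complex.exp (θ * Complex.I)) := by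
      rw [mul_comm (θ : ℂ)]; ring
    rw [e1, e2]
  have hp : Function.Periodic F Real.pi := by
    intro θ
    have : circleMap 0 R (θ + Real.pi) = - circleMap 0 R θ := by
      simp [circleMap_zero, add_mul, Complex.exp_add]
    simp only [hF, this, Complex.cos_neg]
  have h2 : ∫ θ in (0:ℝ)..(2 * Real.pi), F θ = 2 * ∫ θ in (0:ℝ)..Real.pi, F θ := by
    rw [← intervalIntegral.integral_add_adjacent_intervals (b := Real.pi)
      (hFc.intervalIntegrable _ _) (hFc.intervalIntegrable _ _)]
    have := hp.intervalIntegral_add_eq Real.pi 0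
    rw [zero_add, ← two_mul] at this
    rw [this]; ring
  rw [hI, circleIntegral, mul_right_comm, ← h2, mul_comm, ← intervalIntegral.integral_const_mul]
  congr 1
  funext θ
  have : circleMap 0 R θ ≠ 0 := by
    rw [← norm_ne_zero_iff, norm_circleMap_zero, abs_of_pos hR]; exact hR.ne'
  simp only [deriv_circleMap, smul_eq_mul, hF, sub_zero]
  field_simp

lemma aux_cos {z : ℂ} (hz : ‖z‖ < 3 * Real.pi / 2) (h : Complex.cos z = 0) :
    z = Real.pi / 2 ∨ z = -(Real.pi / 2) := by
  obtain ⟨k, hk⟩ := Complex.cos_eq_zero_iff.1 h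
  have hk' : z = (((2 * k + 1) * Real.pi / 2 : ℝ) : ℂ) := by rw [hk]; push_cast; ring
  rw [hk', Complex.norm_real, Real.norm_eq_abs, abs_lt] at hz
  have hp := Real.pi_pos
  have h1 : (k:ℝ) < 1 := by nlinarith
  have h2 : (-2:ℝ) < k := by nlinarith
  have h1' : k < 1 := by exact_mod_cast h1
  have h2' : -2 < k := by exact_mod_cast h2
  have : k = 0 ∨ k = -1 := by omega
  rcases this with rfl | rfl
  · left; rw [hk]; push_cast; ring
  · right; rw [hk]; push_cast; ring

lemma aux_norm : ‖(Real.pi / 2 : ℂ)‖ = Real.pi / 2 := by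
  have : (Real.pi / 2 : ℂ) = ((Real.pi / 2 : ℝ) : ℂ) := by push_cast; ring
  rw [this, Complex.norm_real, Real.norm_eq_abs, abs_of_pos (by positivity)]

lemma aux_small (R : ℝ) (h0 : 0 < R) (h1 : R < Real.pi / 2) : Ifun R = Real.pi / 2 := by
  have hc : ∀ z : ℂ, ‖z‖ ≤ R → Complex.cos z ≠ 0 := by
    intro z hz h
    rcases aux_cos (by linarith [Real.pi_pos]) h with rfl | rfl
    · rw [aux_norm] at hz; linarith
    · rw [norm_neg, aux_norm] at hz; linarith
  have hk := aux_key R h0 (fun z hz => hc z hz.le)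
  have hd : DifferentiableOn ℂ (fun z => 1 / (2 * Complex.cos z)) (Metric.closedBall 0 R) := by
    intro z hz
    refine DifferentiableAt.differentiableWithinAt ?_
    have := hc z (by simpa using hz)
    fun_prop (disch := simpa using this)
  have := hd.circleIntegral_sub_inv_smul (w := 0) (by simpa using h0)
  simp only [smul_eq_mul] at this
  rw [this] at hk
  have hI : (2 * Complex.I) ≠ 0 := by simp
  apply mul_left_cancel₀ hI
  rw [hk]; simp; ring

/-- Entire quotient of cosine by its two smallest zeros. -/
lemma aux_q : ∃ q : ℂ → ℂ, Differentiable ℂ q ∧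
    (∀ z, Complex.cos z = (z - Real.pi / 2) * ((z + Real.pi / 2) * q z)) ∧
    q (Real.pi / 2) = -1 / Real.pi ∧ q (-(Real.pi / 2)) = -1 / Real.pi := by
  have hds : ∀ (f : ℂ → ℂ) (a : ℂ), Differentiable ℂ f → Differentiable ℂ (dslope f a) := by
    intro f a hf
    rw [← differentiableOn_univ, Complex.differentiableOn_dslope Filter.univ_mem]
    exact hf.differentiableOn
  set a : ℂ := Real.pi / 2 with ha
  have hpi : (Real.pi : ℂ) ≠ 0 := by exact_mod_cast Real.pi_ne_zero
  have ha0 : a ≠ 0 := by rw [ha]; simp [hpi]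
  have hca : Complex.cos a = 0 := by rw [ha]; exact Complex.cos_pi_div_two
  have hsa : Complex.sin a = 1 := by rw [ha]; exact Complex.sin_pi_div_two
  set p := dslope Complex.cos a with hp
  have hpd : Differentiable ℂ p := hds _ _ Complex.differentiable_cos
  have hpc : ∀ z, Complex.cos z = (z - a) * p z := by
    intro z
    have := sub_smul_dslope Complex.cos a z
    rw [smul_eq_mul, hca, sub_zero] at this
    exact this.symm
  have hpa : p (-a) = 0 := by
    have := hpc (-a)
    rw [Complex.cos_neg, hca] at this
    rcases mul_eq_zero.1 this.symm with h | h
    · exfalso; apply ha0; linear_combination -(1/2) * h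
    · exact h
  set q := dslope p (-a) with hq
  have hqc : ∀ z, p z = (z + a) * q z := by
    intro z
    have := sub_smul_dslope p (-a) z
    rw [smul_eq_mul, hpa, sub_zero, sub_neg_eq_add] at this
    exact this.symm
  have hqd : Differentiable ℂ q := hds _ _ hpd
  have hder : ∀ z, -Complex.sin z = (2 * z) * q z + (z - a) * (z + a) * deriv q z := by
    intro z
    have h1 := Complex.hasDerivAt_cos z
    have h2 : HasDerivAt (fun z => (z - a) * ((z + a) * q z)) _ z :=
      ((hasDerivAt_id z).sub_const a).mul
      (((hasDerivAt_id z).add_const a).mul (hqd z).hasDerivAt)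
    have h3 : Complex.cos = fun z => (z - a) * ((z + a) * q z) := by
      funext z; rw [hpc, hqc]
    rw [← h3] at h2
    rw [h1.unique h2]; simp; ring
  refine ⟨q, hqd, fun z => by rw [hpc, hqc], ?_, ?_⟩
  · have := hder a
    rw [hsa] at this
    rw [eq_div_iff hpi]
    have h2 : (Real.pi : ℂ) = 2 * a := by rw [ha]; ring
    rw [h2]; linear_combination -this
  · have := hder (-a)
    rw [Complex.sin_neg, hsa] at this
    rw [eq_div_iff hpi]
    have h2 : (Real.pi : ℂ) = 2 * a := by rw [ha]; ring
    rw [h2]; linear_combination this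

lemma aux_large (R : ℝ) (h0 : Real.pi / 2 < R) (h1 : R < 3 * Real.pi / 2) :
    Ifun R = Real.pi / 2 - 2 := by
  have hpp := Real.pi_pos
  have hR : 0 < R := by linarith
  have hpi : (Real.pi : ℂ) ≠ 0 := by exact_mod_cast Real.pi_ne_zero
  have hc : ∀ z : ℂ, ‖z‖ = R → Complex.cos z ≠ 0 := by
    intro z hz h
    rcases aux_cos (by linarith [Real.pi_pos]) h with rfl | rfl
    · rw [aux_norm] at hz; linarith
    · rw [norm_neg, aux_norm] at hz; linarith
  have hk := aux_key R hR hc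
  obtain ⟨q, hqd, hqc, hqa, hqb⟩ := aux_q
  have hq0 : ∀ z : ℂ, ‖z‖ ≤ R → q z ≠ 0 := by
    intro z hz h
    have hcz := hqc z
    rw [h, mul_zero, mul_zero] at hcz
    rcases aux_cos (by linarith) hcz with rfl | rfl
    · rw [hqa] at h; simp [hpi] at h
    · rw [hqb] at h; simp [hpi] at h
  have hd : DifferentiableOn ℂ (fun z => 1 / (2 * q z)) (Metric.closedBall 0 R) := by
    intro z hz
    refine DifferentiableAt.differentiableWithinAt ?_
    have := hq0 z (by simpa using hz)
    have := hqd z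
    fun_prop (disch := simpa)
  have hma : (Real.pi / 2 : ℂ) ∈ Metric.ball (0:ℂ) R := by
    rw [mem_ball_zero_iff, aux_norm]; exact h0
  have hmb : (-(Real.pi / 2) : ℂ) ∈ Metric.ball (0:ℂ) R := by
    rw [mem_ball_zero_iff, norm_neg, aux_norm]; exact h0
  have hm0 : (0 : ℂ) ∈ Metric.ball (0:ℂ) R := by simpa using hR
  have i0 := hd.circleIntegral_sub_inv_smul hm0
  have ia := hd.circleIntegral_sub_inv_smul hma
  have ib := hd.circleIntegral_sub_inv_smul hmb
  simp only [smul_eq_mul] at i0 ia ib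
  have hci : ∀ w ∈ Metric.ball (0:ℂ) R,
      CircleIntegrable (fun z => (z - w)⁻¹ * (1 / (2 * q z))) 0 R := by
    intro w hw
    refine ContinuousOn.circleIntegrable hR.le ?_
    refine ContinuousOn.mul ?_ (hd.continuousOn.mono Metric.sphere_subset_closedBall)
    refine ContinuousOn.inv₀ (by fun_prop) ?_
    intro z hz h
    rw [sub_eq_zero.1 h] at hz
    rw [mem_ball_zero_iff] at hw
    rw [mem_sphere_zero_iff_norm] at hz
    linarith
  have hsplit : (∮ z in C(0, R), (z - 0)⁻¹ * (1 / (2 * Complex.cos z))) =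
      ∮ z in C(0, R), ((-4 / (Real.pi:ℂ)^2) * ((z - 0)⁻¹ * (1 / (2 * q z))) +
        ((2 / (Real.pi:ℂ)^2) * ((z - Real.pi / 2)⁻¹ * (1 / (2 * q z))) +
        (2 / (Real.pi:ℂ)^2) * ((z - (-(Real.pi / 2)))⁻¹ * (1 / (2 * q z))))) := by
    refine circleIntegral.integral_congr hR.le ?_
    intro z hz
    rw [mem_sphere_zero_iff_norm] at hz
    have hcz := hc z hz
    have hz0 : z ≠ 0 := by rintro rfl; simp at hz; linarith
    simp only
    rw [hqc z] at hcz ⊢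
    have h1 : z - Real.pi / 2 ≠ 0 := left_ne_zero_of_mul hcz
    have h2 : z + Real.pi / 2 ≠ 0 := left_ne_zero_of_mul (right_ne_zero_of_mul hcz)
    have h3 : q z ≠ 0 := right_ne_zero_of_mul (right_ne_zero_of_mul hcz)
    have hpf : ((z - Real.pi / 2) * (z + Real.pi / 2) * z)⁻¹ = (-4 / (Real.pi:ℂ)^2) * z⁻¹ +
      ((2 / (Real.pi:ℂ)^2) * (z - Real.pi / 2)⁻¹ + (2 / (Real.pi:ℂ)^2) * (z + Real.pi / 2)⁻¹) := by
      rw [inv_eq_iff_eq_inv]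
      symm
      rw [inv_eq_iff_eq_inv]
      generalize hu : z - (Real.pi:ℂ) / 2 = u at *
      generalize hv : z + (Real.pi:ℂ) / 2 = v at *
      have e1 : z = (u + v) / 2 := by rw [← hu, ← hv]; ring
      have e2 : (Real.pi : ℂ) = v - u := by rw [← hu, ← hv]; ring
      rw [e2] at hpi ⊢
      rw [e1] at hz0 ⊢
      have hz0' : u + v ≠ 0 := by intro h; apply hz0; rw [h]; simp
      field_simp
      ring
    rw [sub_zero, sub_neg_eq_add]
    calc _ = ((z - Real.pi / 2) * (z + Real.pi / 2) * z)⁻¹ * (1 / (2 * q z)) := by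
          simp only [one_div, mul_inv]; ring
      _ = _ := by rw [hpf]; ring
  have c0 : CircleIntegrable (fun z => (-4 / (Real.pi:ℂ)^2) * ((z - 0)⁻¹ * (1 / (2 * q z)))) 0 R :=
    (hci _ hm0).const_smul (a := (-4 / (Real.pi:ℂ)^2))
  have ca : CircleIntegrable (fun z => (2 / (Real.pi:ℂ)^2) * ((z - Real.pi / 2)⁻¹ * (1 / (2 * q z)))) 0 R :=
    (hci _ hma).const_smul (a := (2 / (Real.pi:ℂ)^2))
  have cb : CircleIntegrable (fun z => (2 / (Real.pi:ℂ)^2) * ((z - (-(Real.pi / 2)))⁻¹ * (1 / (2 * q z)))) 0 R :=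
    (hci _ hmb).const_smul (a := (2 / (Real.pi:ℂ)^2))
  have cab : CircleIntegrable (fun z =>
      (2 / (Real.pi:ℂ)^2) * ((z - Real.pi / 2)⁻¹ * (1 / (2 * q z))) +
      (2 / (Real.pi:ℂ)^2) * ((z - (-(Real.pi / 2)))⁻¹ * (1 / (2 * q z)))) 0 R := ca.add cb
  have hq00 : q 0 = - 4 / (Real.pi:ℂ)^2 := by
    have := hqc 0
    rw [Complex.cos_zero] at this
    field_simp at this ⊢
    linear_combination this
  rw [hsplit, circleIntegral.integral_add c0 cab, circleIntegral.integral_add ca cb,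
    circleIntegral.integral_const_mul, circleIntegral.integral_const_mul,
    circleIntegral.integral_const_mul, i0, ia, ib, hqa, hqb, hq00] at hk
  have hI : (2 * Complex.I) ≠ 0 := by simp
  apply mul_left_cancel₀ hI
  rw [hk]
  field_simp
  ring

/-- Re I(R) = π/2 for R ∈ (0, π/2), and Re I(R) = π/2 − 2
for R ∈ (π/2, 3π/2). -/
theorem re_contour_integral :
    (∀ R ∈ Set.Ioo (0 : ℝ) (Real.pi / 2), (Ifun R).re = Real.pi / 2) ∧
    (∀ R ∈ Set.Ioo (Real.pi / 2) (3 * Real.pi / 2), (Ifun R).re = Real.pi / 2 - 2) := by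
  constructor
  · rintro R ⟨h0, h1⟩
    rw [aux_small R h0 h1]
    have : (Real.pi / 2 : ℂ) = ((Real.pi / 2 : ℝ) : ℂ) := by push_cast; ring
    rw [this, Complex.ofReal_re]
  · rintro R ⟨h0, h1⟩
    rw [aux_large R h0 h1]
    have : (Real.pi / 2 - 2 : ℂ) = ((Real.pi / 2 - 2 : ℝ) : ℂ) := by push_cast; ring
    rw [this, Complex.ofReal_re]

end
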